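/- arXiv:1606.02766 — 11 statements merged into one kernel-verified Lean document; each statement's English description precedes it below -/
import Mathlib

section
/- Let α < β be real numbers and let f : ℝ → ℝ be continuous on [α,β] and differentiable on (α,β). Then there exist points ξ₋ and ξ₊ with α < ξ₋ < (α+β)/2 < ξ₊ < β such that (f'(ξ₊) − f'(ξ₋))/(ξ₊ − ξ₋) = 2·D(f,α,β). -/
open Set MeasureTheory

/-- The scaled second-order divided difference
`D(f,α,β) = (2f(β) − 4f((α+β)/2) + 2f(α))/(β−α)²`. -/
noncomputable def DD (f : ℝ → ℝ) (α β : ℝ) : ℝ :=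
  (2 * f β - 4 * f ((α + β) / 2) + 2 * f α) / (β - α) ^ 2

/-- For `f` continuous on `[α,β]` and differentiable on `(α,β)` there exist
`α < ξ₋ < (α+β)/2 < ξ₊ < β` with `(f'(ξ₊) − f'(ξ₋))/(ξ₊ − ξ₋) = 2·D(f,α,β)`. -/
theorem stmt0 (f : ℝ → ℝ) (α β : ℝ) (hαβ : α < β)
    (hc : ContinuousOn f (Set.Icc α β))
    (hd : DifferentiableOn ℝ f (Set.Ioo α β)) :
    ∃ ξm ξp : ℝ, α < ξm ∧ ξm < (α + β) / 2 ∧ (α + β) / 2 < ξp ∧ ξp < β ∧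
      (deriv f ξp - deriv f ξm) / (ξp - ξm) = 2 * DD f α β := by
  set D := DD f α β
  have hDD : D * (β - α) ^ 2 = 2 * f β - 4 * f ((α + β) / 2) + 2 * f α :=
    div_mul_cancel₀ _ (pow_ne_zero 2 (sub_ne_zero.2 hαβ.ne'))
  have hderiv : ∀ x ∈ Set.Ioo α β,
      HasDerivAt (fun y => f y - D * y ^ 2) (deriv f x - D * (2 * x)) x := by
    intro x hx
    have h1 : HasDerivAt f (deriv f x) x :=
      (hd.differentiableAt (isOpen_Ioo.mem_nhds hx)).hasDerivAt
    have h2 : HasDerivAt (fun y : ℝ => y ^ 2) (2 * x) x := by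
      simpa using hasDerivAt_pow 2 x
    exact h1.sub (h2.const_mul D)
  have hcont : ContinuousOn (fun y => f y - D * y ^ 2) (Set.Icc α β) :=
    hc.sub (by fun_prop)
  have hαm : α < (α + β) / 2 := by linarith
  have hmβ : (α + β) / 2 < β := by linarith
  obtain ⟨ξm, ⟨hm1, hm2⟩, hm⟩ := exists_hasDerivAt_eq_slope _ _ hαm
    (hcont.mono (Set.Icc_subset_Icc_right hmβ.le))
    (fun x hx => hderiv x ⟨hx.1, hx.2.trans hmβ⟩)
  obtain ⟨ξp, ⟨hp1, hp2⟩, hp⟩ := exists_hasDerivAt_eq_slope _ _ hmβ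
    (hcont.mono (Set.Icc_subset_Icc_left hαm.le))
    (fun x hx => hderiv x ⟨hαm.trans hx.1, hx.2⟩)
  refine ⟨ξm, ξp, hm1, hm2, hp1, hp2, ?_⟩
  have hslope : deriv f ξp - D * (2 * ξp) = deriv f ξm - D * (2 * ξm) := by
    rw [hm, hp, show β - (α + β) / 2 = (α + β) / 2 - α by ring]
    congr 1
    linear_combination -hDD / 2
  rw [div_eq_iff (by linarith)]
  linear_combination hslope
end

section
/- Let a ≤ α < β ≤ b and let f : ℝ → ℝ be differentiable on [a,b]. Then ‖f''‖_{−∞,[α,β]} ≤ 2·|D(f,α,β)| ≤ ‖f''‖_{[α,β]}. -/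
open Set MeasureTheory

/-- `‖f''‖_{[α,β]} := sup_{α ≤ η < ζ ≤ β} |f'(ζ) − f'(η)|/(ζ − η)`,
defined via the derivative `f'`. -/
noncomputable def nSup (f' : ℝ → ℝ) (α β : ℝ) : ℝ :=
  sSup {q : ℝ | ∃ η ζ, α ≤ η ∧ η < ζ ∧ ζ ≤ β ∧ q = |f' ζ - f' η| / (ζ - η)}

/-- `‖f''‖_{−∞,[α,β]} := inf_{α ≤ η < ζ ≤ β} |f'(ζ) − f'(η)|/(ζ − η)`,
defined via the derivative `f'`. -/
noncomputable def nInf (f' : ℝ → ℝ) (α β : ℝ) : ℝ :=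
  sInf {q : ℝ | ∃ η ζ, α ≤ η ∧ η < ζ ∧ ζ ≤ β ∧ q = |f' ζ - f' η| / (ζ - η)}

/-- The second-order divided difference is a difference quotient of the derivative over a step of
half the length of the interval. -/
theorem exists_two_mul_abs_DD_eq {f f' : ℝ → ℝ} {α β : ℝ} (h : α < β)
    (hder : ∀ x ∈ Icc α β, HasDerivWithinAt f (f' x) (Icc α β) x) :
    ∃ η ζ, α ≤ η ∧ η < ζ ∧ ζ ≤ β ∧ 2 * |DD f α β| = |f' ζ - f' η| / (ζ - η) := by
  obtain ⟨s, rfl⟩ : ∃ s, β = α + 2 * s := ⟨(β - α) / 2, by ring⟩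
  have hs : 0 < s := by linarith
  have hcont : ContinuousOn f (Icc α (α + 2 * s)) := fun x hx =>
    (hder x hx).continuousWithinAt
  have hd : ∀ x, α < x → x < α + 2 * s → HasDerivAt f (f' x) x := fun x hx hx' =>
    (hder x ⟨hx.le, hx'.le⟩).hasDerivAt (Icc_mem_nhds hx hx')
  obtain ⟨ξ, ⟨hξ, hξ'⟩, hslope⟩ := exists_hasDerivAt_eq_slope
    (fun x => f (x + s) - f x) (fun x => f' (x + s) - f' x) (show α < α + s by linarith)
    (ContinuousOn.sub
      (hcont.comp (by fun_prop) fun x hx => ⟨by linarith [hx.1], by linarith [hx.2]⟩)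
      (hcont.mono fun x hx => ⟨hx.1, by linarith [hx.2]⟩))
    (fun x hx => ((hd (x + s) (by linarith [hx.1]) (by linarith [hx.2])).comp_add_const x s).sub
      (hd x hx.1 (by linarith [hx.2])))
  refine ⟨ξ, ξ + s, hξ.le, by linarith, by linarith, ?_⟩
  have hDD : DD f α (α + 2 * s) = (f' (ξ + s) - f' ξ) / (2 * s) := by
    rw [hslope, DD, show (α + (α + 2 * s)) / 2 = α + s by ring,
      show α + s + s = α + 2 * s by ring]
    have := hs.ne'
    simp only [add_sub_cancel_left]
    field_simp
    ring
  rw [hDD, abs_div, abs_of_pos (show 0 < 2 * s by linarith), add_sub_cancel_left]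
  field_simp

/-- `‖f''‖_{−∞,[α,β]} ≤ 2|D(f,α,β)| ≤ ‖f''‖_{[α,β]}` for `f` differentiable on
`[a,b] ⊇ [α,β]`.  The second inequality is expressed by saying that
`2|D(f,α,β)|` is at most every upper bound of the difference quotients of `f'`
on `[α,β]` (i.e. `2|D(f,α,β)| ≤ ‖f''‖_{[α,β]}` even when the latter is `∞`). -/
theorem stmt1 (a b α β : ℝ) (f f' : ℝ → ℝ)
    (h1 : a ≤ α) (h2 : α < β) (h3 : β ≤ b)
    (hder : ∀ x ∈ Set.Icc a b, HasDerivWithinAt f (f' x) (Set.Icc a b) x) :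
    nInf f' α β ≤ 2 * |DD f α β| ∧
    ∀ K : ℝ, (∀ η ζ, α ≤ η → η < ζ → ζ ≤ β → |f' ζ - f' η| / (ζ - η) ≤ K) →
      2 * |DD f α β| ≤ K := by
  have hsub : Icc α β ⊆ Icc a b := Icc_subset_Icc h1 h3
  obtain ⟨η, ζ, hη, hηζ, hζ, heq⟩ := exists_two_mul_abs_DD_eq h2
    fun x hx => (hder x (hsub hx)).mono hsub
  refine ⟨csInf_le ⟨0, ?_⟩ ⟨η, ζ, hη, hηζ, hζ, heq⟩, fun K hK => heq ▸ hK η ζ hη hηζ hζ⟩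
  rintro _ ⟨u, v, -, huv, -, rfl⟩
  exact div_nonneg (abs_nonneg _) (sub_pos.2 huv).le
end

section
/- Let f belong to the cone 𝒞 = 𝒞(a,b,n_init,C₀). Let [α,β] ⊆ [a,b] with α < β and let h₋, h₊ ∈ (β−α, 𝔥) satisfy β−h₋ ≥ a and α+h₊ ≤ b. Let L be the linear interpolant of f at α and β, i.e., L(x) = ((β−x)·f(α) + (x−α)·f(β))/(β−α). Then sup_{x∈[α,β]} |f(x) − L(x)| ≤ ((β−α)²/8) · max( C(h₋)·‖f''‖_{−∞,[β−h₋,α]}, C(h₊)·‖f''‖_{−∞,[β,α+h₊]} ). -/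
open Set MeasureTheory

/-- `𝔥 := 3(b−a)/(n_init − 1)`. -/
noncomputable def littleh (a b : ℝ) (nInit : ℕ) : ℝ := 3 * (b - a) / ((nInit : ℝ) - 1)

/-- `С(h) := C₀𝔥/(𝔥 − h)`. -/
noncomputable def Cfun (a b : ℝ) (nInit : ℕ) (C₀ h : ℝ) : ℝ :=
  C₀ * littleh a b nInit / (littleh a b nInit - h)

/-- The bound `B(f,α,β,h₋,h₊)` from the definition of the cone `𝒞`. -/
noncomputable def Bfun (a b : ℝ) (nInit : ℕ) (C₀ : ℝ) (f' : ℝ → ℝ) (α β hm hp : ℝ) : ℝ :=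
  if a ≤ β - hm then
    if α + hp ≤ b then
      max (Cfun a b nInit C₀ hm * nInf f' (β - hm) α)
        (Cfun a b nInit C₀ hp * nInf f' β (α + hp))
    else Cfun a b nInit C₀ hm * nInf f' (β - hm) α
  else Cfun a b nInit C₀ hp * nInf f' β (α + hp)

/-- Membership of `f` (with derivative `f'`) in the cone `𝒞(a,b,n_init,C₀)`:
`f ∈ W^{2,∞}[a,b]` (differentiable on `[a,b]` with Lipschitz derivative) and
`‖f''‖_{[α,β]} ≤ B(f,α,β,h₋,h₊)` for all admissible `α, β, h₋, h₊`. -/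
def ConeWith (a b : ℝ) (nInit : ℕ) (C₀ : ℝ) (f f' : ℝ → ℝ) : Prop :=
  (∀ x ∈ Set.Icc a b, HasDerivWithinAt f (f' x) (Set.Icc a b) x) ∧
  (∃ K : ℝ, ∀ η ζ, a ≤ η → η < ζ → ζ ≤ b → |f' ζ - f' η| ≤ K * (ζ - η)) ∧
  ∀ α β hm hp, a ≤ α → α < β → β ≤ b →
    β - α < hm → hm < littleh a b nInit → β - α < hp → hp < littleh a b nInit →
    (a ≤ β - hm ∨ α + hp ≤ b) →
    nSup f' α β ≤ Bfun a b nInit C₀ f' α β hm hp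

/-- `f ∈ 𝒞(a,b,n_init,C₀)`. -/
def InCone (a b : ℝ) (nInit : ℕ) (C₀ : ℝ) (f : ℝ → ℝ) : Prop :=
  ∃ f' : ℝ → ℝ, ConeWith a b nInit C₀ f f'

/-- If the derivative of `f` decreases at rate at most `M` on `[α,β]`, then `f` exceeds its linear
interpolant at `α` and `β` by at most `M (x - α) (β - x) / 2`. -/
theorem sub_linearInterpolant_le {f f' : ℝ → ℝ} {α β M : ℝ} (hαβ : α < β)
    (hf : ∀ x ∈ Icc α β, HasDerivWithinAt f (f' x) (Icc α β) x)
    (hM : ∀ η ζ, α ≤ η → η < ζ → ζ ≤ β → f' η - f' ζ ≤ M * (ζ - η))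
    {x : ℝ} (hx : x ∈ Icc α β) :
    f x - ((β - x) * f α + (x - α) * f β) / (β - α) ≤ M / 2 * ((x - α) * (β - x)) := by
  have hd : ∀ y ∈ Icc α β,
      HasDerivWithinAt (fun z => f z + M / 2 * z ^ 2) (f' y + M * y) (Icc α β) y := by
    intro y hy
    have h := (hf y hy).add (((hasDerivAt_pow 2 y).const_mul (M / 2)).hasDerivWithinAt)
    exact h.congr_deriv (by push_cast; ring)
  have hderiv : ∀ y ∈ interior (Icc α β), HasDerivAt (fun z => f z + M / 2 * z ^ 2)
      (f' y + M * y) y := fun y hy =>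
    (hd y (interior_subset hy)).hasDerivAt (mem_interior_iff_mem_nhds.mp hy)
  have hconv : ConvexOn ℝ (Icc α β) (fun z => f z + M / 2 * z ^ 2) := by
    refine MonotoneOn.convexOn_of_deriv (convex_Icc α β)
      (fun y hy => (hd y hy).continuousWithinAt)
      (fun y hy => (hderiv y hy).differentiableAt.differentiableWithinAt) ?_
    intro y hy z hz hyz
    rw [(hderiv y hy).deriv, (hderiv z hz).deriv]
    rcases hyz.eq_or_lt with rfl | hlt
    · exact le_rfl
    · linarith [hM y z (interior_subset hy).1 hlt (interior_subset hz).2]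
  have hpos : 0 < β - α := sub_pos.mpr hαβ
  have key := hconv.2 (left_mem_Icc.mpr hαβ.le) (right_mem_Icc.mpr hαβ.le)
    (div_nonneg (sub_nonneg.mpr hx.2) hpos.le) (div_nonneg (sub_nonneg.mpr hx.1) hpos.le)
    (by field_simp; ring)
  have hpt : (β - x) / (β - α) * α + (x - α) / (β - α) * β = x := by
    field_simp; ring
  simp only [smul_eq_mul, hpt] at key
  have hrhs : (β - x) / (β - α) * (f α + M / 2 * α ^ 2)
      + (x - α) / (β - α) * (f β + M / 2 * β ^ 2)
      = ((β - x) * f α + (x - α) * f β) / (β - α) + M / 2 * ((x - α) * (β - x) + x ^ 2) := by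
    field_simp; ring
  linarith

/-- Error bound for linear interpolation when the derivative is `M`-Lipschitz. -/
theorem abs_sub_linearInterpolant_le {f f' : ℝ → ℝ} {α β M : ℝ} (hαβ : α < β)
    (hf : ∀ x ∈ Icc α β, HasDerivWithinAt f (f' x) (Icc α β) x)
    (hM : ∀ η ζ, α ≤ η → η < ζ → ζ ≤ β → |f' ζ - f' η| ≤ M * (ζ - η))
    {x : ℝ} (hx : x ∈ Icc α β) :
    |f x - ((β - x) * f α + (x - α) * f β) / (β - α)| ≤ (β - α) ^ 2 / 8 * M := by
  have hM0 : 0 ≤ M := by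
    have h := (abs_nonneg _).trans (hM α β le_rfl hαβ le_rfl)
    exact nonneg_of_mul_nonneg_left h (sub_pos.mpr hαβ)
  have h1 := sub_linearInterpolant_le hαβ hf
    (fun η ζ h h' h'' => by linarith [neg_le_of_abs_le (hM η ζ h h' h'')]) hx
  have h2 := sub_linearInterpolant_le (M := M) hαβ (fun y hy => (hf y hy).neg)
    (fun η ζ h h' h'' => by linarith [le_of_abs_le (hM η ζ h h' h'')]) hx
  simp only [Pi.neg_apply, mul_neg, ← neg_add, neg_div, sub_neg_eq_add] at h2
  have h3 : M / 2 * ((x - α) * (β - x)) ≤ (β - α) ^ 2 / 8 * M := by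
    nlinarith [mul_nonneg hM0 (sq_nonneg (x - α - (β - x)))]
  exact abs_le.mpr ⟨by linarith, by linarith⟩

/-- Difference quotients of a Lipschitz `f'` are bounded by `nSup`. -/
theorem abs_sub_le_nSup_mul {f' : ℝ → ℝ} {α β K : ℝ}
    (hK : ∀ η ζ, α ≤ η → η < ζ → ζ ≤ β → |f' ζ - f' η| ≤ K * (ζ - η))
    {η ζ : ℝ} (hη : α ≤ η) (hηζ : η < ζ) (hζ : ζ ≤ β) :
    |f' ζ - f' η| ≤ nSup f' α β * (ζ - η) := by
  rw [← div_le_iff₀ (sub_pos.mpr hηζ)]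
  refine le_csSup ⟨K, ?_⟩ ⟨η, ζ, hη, hηζ, hζ, rfl⟩
  rintro q ⟨u, v, hu, huv, hv, rfl⟩
  exact (div_le_iff₀ (sub_pos.mpr huv)).mpr (hK u v hu huv hv)

/-- Linear-spline error bound on `[α,β]` for `f` in the cone `𝒞`:
`sup_{x∈[α,β]} |f(x) − L(x)|
  ≤ ((β−α)²/8)·max(C(h₋)‖f''‖_{−∞,[β−h₋,α]}, C(h₊)‖f''‖_{−∞,[β,α+h₊]})`. -/
theorem stmt2 (a b : ℝ) (hab : a < b) (nInit : ℕ) (hn : 5 ≤ nInit)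
    (C₀ : ℝ) (hC : 1 ≤ C₀) (f f' : ℝ → ℝ)
    (hf : ConeWith a b nInit C₀ f f')
    (α β hm hp : ℝ) (h1 : a ≤ α) (h2 : α < β) (h3 : β ≤ b)
    (hm1 : β - α < hm) (hm2 : hm < littleh a b nInit)
    (hp1 : β - α < hp) (hp2 : hp < littleh a b nInit)
    (hmL : a ≤ β - hm) (hpR : α + hp ≤ b) :
    ∀ x ∈ Set.Icc α β,
      |f x - ((β - x) * f α + (x - α) * f β) / (β - α)| ≤
        ((β - α) ^ 2 / 8) *
          max (Cfun a b nInit C₀ hm * nInf f' (β - hm) α)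
            (Cfun a b nInit C₀ hp * nInf f' β (α + hp)) := by
  obtain ⟨hderiv, ⟨K, hK⟩, hcone⟩ := hf
  intro x hx
  have hsup := hcone α β hm hp h1 h2 h3 hm1 hm2 hp1 hp2 (Or.inl hmL)
  rw [Bfun, if_pos hmL, if_pos hpR] at hsup
  refine (abs_sub_linearInterpolant_le h2
    (fun y hy => (hderiv y ⟨h1.trans hy.1, hy.2.trans h3⟩).mono (Icc_subset_Icc h1 h3))
    (fun η ζ hη hηζ hζ => abs_sub_le_nSup_mul
      (fun u v hu huv hv => hK u v (h1.trans hu) huv (hv.trans h3)) hη hηζ hζ) hx).trans ?_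
  exact mul_le_mul_of_nonneg_left hsup (by positivity)
end

section
/- (Validity of Algorithm A's data-driven stopping criterion.) Let f belong to the cone 𝒞 = 𝒞(a,b,n_init,C₀) and let ε > 0. Let [α,β] ⊆ [a,b] with α < β and let h₋, h₊ ∈ (β−α, 𝔥) satisfy β−h₋ ≥ a and α+h₊ ≤ b. Suppose the two divided-difference quantities computed from function values satisfy (1/4)·C(h₋)·h₋²·|D(f, β−h₋, α)| ≤ ε and (1/4)·C(h₊)·h₊²·|D(f, β, α+h₊)| ≤ ε. Then the linear interpolant L of f at α and β, L(x) = ((β−x)·f(α) + (x−α)·f(β))/(β−α), satisfies sup_{x∈[α,β]} |f(x) − L(x)| ≤ ε. -/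
open Set MeasureTheory

/-- The smallest difference quotient of `f'` on `[γ, δ]` is at most twice the absolute value of
the scaled second-order divided difference. -/
lemma nInf_le_two_mul_abs_DD {f f' : ℝ → ℝ} {γ δ : ℝ} (h : γ < δ)
    (hd : ∀ x ∈ Icc γ δ, HasDerivWithinAt f (f' x) (Icc γ δ) x) :
    nInf f' γ δ ≤ 2 * |DD f γ δ| := by
  set r := (δ - γ) / 2 with hr
  have hr0 : 0 < r := by rw [hr]; linarith
  have hδ : δ = γ + 2 * r := by rw [hr]; ring
  have hcont : ContinuousOn f (Icc γ δ) := fun x hx => (hd x hx).continuousWithinAt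
  have hderiv : ∀ x ∈ Ioo γ δ, HasDerivAt f (f' x) x := fun x hx =>
    (hd x (Ioo_subset_Icc_self hx)).hasDerivAt (Icc_mem_nhds hx.1 hx.2)
  obtain ⟨c, hc, hceq⟩ := exists_hasDerivAt_eq_slope (fun t => f (t + r) - f t)
    (fun t => f' (t + r) - f' t) (a := γ) (b := γ + r) (by linarith)
    ((hcont.comp (by fun_prop) fun t ht => ⟨by linarith [ht.1], by linarith [ht.2]⟩).sub
      (hcont.mono (Icc_subset_Icc_right (by linarith))))
    (fun t ht => ((hderiv (t + r) ⟨by linarith [ht.1], by linarith [ht.2]⟩).comp_add_const t r).sub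
      (hderiv t ⟨ht.1, by linarith [ht.2]⟩))
  have hmem : nInf f' γ δ ≤ |f' (c + r) - f' c| / (c + r - c) :=
    csInf_le ⟨0, by
        rintro q ⟨η, ζ, -, hlt, -, rfl⟩
        exact div_nonneg (abs_nonneg _) (by linarith)⟩
      ⟨c, c + r, hc.1.le, by linarith, by linarith [hc.2], rfl⟩
  have hDD : 2 * DD f γ δ = (f' (c + r) - f' c) / (c + r - c) := by
    rw [hceq, DD, show (γ + δ) / 2 = γ + r by rw [hδ]; ring, hδ,
      show γ + 2 * r = γ + r + r by ring]
    rw [show γ + r + r - γ = 2 * r by ring, show γ + r - γ = r by ring,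
      show c + r - c = r by ring]
    field_simp
    ring
  refine hmem.trans_eq ?_
  rw [← abs_two, ← abs_mul, hDD, abs_div, abs_of_pos (show 0 < c + r - c by linarith)]

/-- If `x ↦ M x - f' x` is monotone on `[α, β]`, then `f` lies above its linear interpolant minus
`M (β - α)² / 8`. -/
lemma interpolant_sub_le_of_monotoneOn {f f' : ℝ → ℝ} {α β M : ℝ} (h : α < β) (hM : 0 ≤ M)
    (hd : ∀ x ∈ Icc α β, HasDerivWithinAt f (f' x) (Icc α β) x)
    (hmono : MonotoneOn (fun t => M * t - f' t) (Icc α β)) {x : ℝ} (hx : x ∈ Icc α β) :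
    ((β - x) * f α + (x - α) * f β) / (β - α) - f x ≤ M * (β - α) ^ 2 / 8 := by
  have hderiv : ∀ t ∈ interior (Icc α β),
      HasDerivAt (fun t => M * t ^ 2 / 2 - f t) (M * t - f' t) t := by
    intro t ht
    rw [interior_Icc] at ht
    have h1 := (hd t (Ioo_subset_Icc_self ht)).hasDerivAt (Icc_mem_nhds ht.1 ht.2)
    have h2 := (((hasDerivAt_pow 2 t).const_mul M).div_const 2).sub h1
    exact h2.congr_deriv (by push_cast; ring)
  have hconv : ConvexOn ℝ (Icc α β) (fun t => M * t ^ 2 / 2 - f t) := by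
    refine MonotoneOn.convexOn_of_deriv (convex_Icc α β) ?_
      (fun t ht => (hderiv t ht).differentiableAt.differentiableWithinAt) ?_
    · exact ContinuousOn.sub (by fun_prop) fun t ht => (hd t ht).continuousWithinAt
    · exact (hmono.mono interior_subset).congr fun t ht => (hderiv t ht).deriv.symm
  have hβα : 0 < β - α := sub_pos.2 h
  have hJ := hconv.2 (left_mem_Icc.2 h.le) (right_mem_Icc.2 h.le)
    (div_nonneg (sub_nonneg.2 hx.2) hβα.le) (div_nonneg (sub_nonneg.2 hx.1) hβα.le)
    (by field_simp; ring)
  have hpt : ((β - x) / (β - α)) • α + ((x - α) / (β - α)) • β = x := by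
    simp only [smul_eq_mul]
    field_simp
    ring
  rw [hpt] at hJ
  simp only [smul_eq_mul] at hJ
  have hsq : (β - x) / (β - α) * (M * α ^ 2 / 2) + (x - α) / (β - α) * (M * β ^ 2 / 2)
      = M * x ^ 2 / 2 + M * ((x - α) * (β - x)) / 2 := by
    field_simp
    ring
  have hL : ((β - x) * f α + (x - α) * f β) / (β - α)
      = (β - x) / (β - α) * f α + (x - α) / (β - α) * f β := by ring
  have hM' := mul_nonneg hM (sq_nonneg (2 * x - α - β))
  rw [hL]
  nlinarith

/-- The error of linear interpolation under a Lipschitz bound on the derivative. -/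
lemma abs_sub_interpolant_le {f f' : ℝ → ℝ} {α β M : ℝ} (h : α < β) (hM : 0 ≤ M)
    (hd : ∀ x ∈ Icc α β, HasDerivWithinAt f (f' x) (Icc α β) x)
    (hlip : ∀ η ζ, α ≤ η → η < ζ → ζ ≤ β → |f' ζ - f' η| ≤ M * (ζ - η))
    {x : ℝ} (hx : x ∈ Icc α β) :
    |f x - ((β - x) * f α + (x - α) * f β) / (β - α)| ≤ M * (β - α) ^ 2 / 8 := by
  have key : ∀ s ∈ Icc α β, ∀ t ∈ Icc α β, s ≤ t → |f' t - f' s| ≤ M * (t - s) := by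
    intro s hs t ht hst
    rcases hst.eq_or_lt with rfl | hlt
    · simp
    · exact hlip s t hs.1 hlt ht.2
  have h1 := interpolant_sub_le_of_monotoneOn h hM hd (fun s hs t ht hst => by
    have := (abs_le.1 (key s hs t ht hst)).2
    simp only
    linarith) hx
  have h2 := interpolant_sub_le_of_monotoneOn (f := fun t => -f t) (f' := fun t => -f' t) h hM
    (fun t ht => (hd t ht).neg) (fun s hs t ht hst => by
    have := (abs_le.1 (key s hs t ht hst)).1
    simp only
    linarith) hx
  have h3 : ((β - x) * -f α + (x - α) * -f β) / (β - α)
      = -(((β - x) * f α + (x - α) * f β) / (β - α)) := by ring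
  rw [h3] at h2
  exact abs_le.2 ⟨by linarith, by linarith⟩

lemma Cfun_nonneg {a b C₀ h : ℝ} {nInit : ℕ} (hC : 0 ≤ C₀) (h0 : 0 ≤ h)
    (hh : h < littleh a b nInit) : 0 ≤ Cfun a b nInit C₀ h :=
  div_nonneg (mul_nonneg hC (h0.trans hh.le)) (sub_nonneg.2 hh.le)

/-- Validity of Algorithm A's data-driven stopping criterion: if the two
divided-difference error estimators are at most `ε`, then the linear
interpolant of `f ∈ 𝒞` at `α` and `β` has `L^∞`-error at most `ε` on `[α,β]`. -/
theorem stmt3 (a b : ℝ) (hab : a < b) (nInit : ℕ) (hn : 5 ≤ nInit)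
    (C₀ : ℝ) (hC : 1 ≤ C₀) (f f' : ℝ → ℝ)
    (hf : ConeWith a b nInit C₀ f f') (ε : ℝ) (hε : 0 < ε)
    (α β hm hp : ℝ) (h1 : a ≤ α) (h2 : α < β) (h3 : β ≤ b)
    (hm1 : β - α < hm) (hm2 : hm < littleh a b nInit)
    (hp1 : β - α < hp) (hp2 : hp < littleh a b nInit)
    (hmL : a ≤ β - hm) (hpR : α + hp ≤ b)
    (hest1 : (1 / 4) * Cfun a b nInit C₀ hm * hm ^ 2 * |DD f (β - hm) α| ≤ ε)
    (hest2 : (1 / 4) * Cfun a b nInit C₀ hp * hp ^ 2 * |DD f β (α + hp)| ≤ ε) :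
    ∀ x ∈ Set.Icc α β,
      |f x - ((β - x) * f α + (x - α) * f β) / (β - α)| ≤ ε := by
  obtain ⟨hd, ⟨K, hK⟩, hcone⟩ := hf
  have hdm : ∀ {γ δ : ℝ}, a ≤ γ → δ ≤ b →
      ∀ x ∈ Icc γ δ, HasDerivWithinAt f (f' x) (Icc γ δ) x := fun hγ hδ x hx =>
    (hd x (Icc_subset_Icc hγ hδ hx)).mono (Icc_subset_Icc hγ hδ)
  have hquot : ∀ η ζ, α ≤ η → η < ζ → ζ ≤ β → |f' ζ - f' η| / (ζ - η) ≤ nSup f' α β := by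
    intro η ζ hη hlt hζ
    refine le_csSup ⟨K, ?_⟩ ⟨η, ζ, hη, hlt, hζ, rfl⟩
    rintro q ⟨s, t, hs, hst, ht, rfl⟩
    exact (div_le_iff₀ (sub_pos.2 hst)).2 (hK s t (h1.trans hs) hst (ht.trans h3))
  have hM : 0 ≤ nSup f' α β :=
    (div_nonneg (abs_nonneg _) (sub_nonneg.2 h2.le)).trans (hquot α β le_rfl h2 le_rfl)
  have hbound := hcone α β hm hp h1 h2 h3 hm1 hm2 hp1 hp2 (Or.inl hmL)
  rw [Bfun, if_pos hmL, if_pos hpR] at hbound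
  have hest : ∀ {C h N D : ℝ}, 0 ≤ C → β - α < h → N ≤ 2 * D → 0 ≤ D → nSup f' α β ≤ C * N →
      1 / 4 * C * h ^ 2 * D ≤ ε → nSup f' α β * (β - α) ^ 2 / 8 ≤ ε := by
    intro C h N D hC0 hh hN hD hS hε'
    have hsq : (β - α) ^ 2 ≤ h ^ 2 := pow_le_pow_left₀ (sub_nonneg.2 h2.le) hh.le 2
    have := mul_le_mul (hS.trans (mul_le_mul_of_nonneg_left hN hC0)) hsq (sq_nonneg _)
      (by positivity)
    linarith
  intro x hx
  refine (abs_sub_interpolant_le h2 hM (hdm h1 h3) (fun η ζ hη hlt hζ =>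
    (div_le_iff₀ (sub_pos.2 hlt)).1 (hquot η ζ hη hlt hζ)) hx).trans ?_
  rcases le_max_iff.1 hbound with hb | hb
  · exact hest (Cfun_nonneg (by linarith) (by linarith) hm2) hm1
      (nInf_le_two_mul_abs_DD (by linarith) (hdm hmL (by linarith))) (abs_nonneg _) hb hest1
  · exact hest (Cfun_nonneg (by linarith) (by linarith) hp2) hp1
      (nInf_le_two_mul_abs_DD (by linarith) (hdm (by linarith) hpR)) (abs_nonneg _) hb hest2
end

section
/- Let f belong to the cone 𝒞 = 𝒞(a,b,n_init,C₀), and suppose in addition that f' is differentiable at every point of (a,b) except possibly at finitely many points, with second derivative f''(x) at those points, and that x ↦ √|f''(x)| is integrable on [a,b]. Then (4𝔥²/(27·C₀))·‖f''‖_{[a,b]} ≤ (∫_a^b √|f''(x)| dx)². -/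
open Set MeasureTheory

/-- A difference quotient is dominated by one over an arbitrarily short subinterval. -/
lemma exists_short_quotient_ge (g : ℝ → ℝ) (δ : ℝ) (hδ : 0 < δ) {η ζ : ℝ} (h : η < ζ) :
    ∃ α β, η ≤ α ∧ α < β ∧ β ≤ ζ ∧ β - α < δ ∧
      |g ζ - g η| / (ζ - η) ≤ |g β - g α| / (β - α) := by
  have bisect : ∀ n : ℕ, ∃ α β, η ≤ α ∧ α < β ∧ β ≤ ζ ∧ β - α = (ζ - η) * (1 / 2) ^ n ∧
      |g ζ - g η| / (ζ - η) ≤ |g β - g α| / (β - α) := by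
    intro n
    induction n with
    | zero => exact ⟨η, ζ, le_rfl, h, le_rfl, by simp, le_rfl⟩
    | succ n ih =>
      obtain ⟨α, β, h₁, h₂, h₃, h₄, h₅⟩ := ih
      set q := |g ζ - g η| / (ζ - η)
      set μ := (α + β) / 2 with hμ
      have hβ : 0 < β - α := sub_pos.2 h₂
      rw [le_div_iff₀ hβ] at h₅
      have htri := abs_sub_le (g β) (g μ) (g α)
      rcases le_total (q * (μ - α)) |g μ - g α| with hl | hl
      · refine ⟨α, μ, h₁, by linarith, by linarith, by rw [pow_succ]; linarith, ?_⟩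
        rwa [le_div_iff₀ (by linarith)]
      · refine ⟨μ, β, by linarith, by linarith, h₃, by rw [pow_succ]; linarith, ?_⟩
        rw [le_div_iff₀ (by linarith)]
        have : q * (β - α) = q * (μ - α) + q * (β - μ) := by ring
        linarith
  have hpos : 0 < ζ - η := sub_pos.2 h
  obtain ⟨n, hn⟩ := exists_pow_lt_of_lt_one (div_pos hδ hpos) (by norm_num : (1 / 2 : ℝ) < 1)
  obtain ⟨α, β, h₁, h₂, h₃, h₄, h₅⟩ := bisect n
  refine ⟨α, β, h₁, h₂, h₃, ?_, h₅⟩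
  rw [lt_div_iff₀ hpos] at hn
  linarith

lemma nInf_le_quotient (g : ℝ → ℝ) {c d η ζ : ℝ} (h₁ : c ≤ η) (h₂ : η < ζ) (h₃ : ζ ≤ d) :
    nInf g c d ≤ |g ζ - g η| / (ζ - η) := by
  refine csInf_le ⟨0, ?_⟩ ⟨η, ζ, h₁, h₂, h₃, rfl⟩
  rintro _ ⟨s, t, -, hst, -, rfl⟩
  exact div_nonneg (abs_nonneg _) (sub_pos.2 hst).le

lemma nInf_le_abs_deriv {g : ℝ → ℝ} {c d x g'x : ℝ} (hx : x ∈ Ioo c d)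
    (hg : HasDerivAt g g'x x) : nInf g c d ≤ |g'x| := by
  have hslope : Filter.Tendsto (fun t => |slope g x t|) (nhdsWithin x (Ioi x)) (nhds |g'x|) :=
    ((hasDerivAt_iff_tendsto_slope.1 hg).mono_left
      (nhdsWithin_mono x fun _ ht => ne_of_gt ht)).abs
  refine ge_of_tendsto hslope ?_
  filter_upwards [Ioo_mem_nhdsGT hx.2] with t ht
  rw [slope_def_field, abs_div, abs_of_pos (sub_pos.2 ht.1)]
  exact nInf_le_quotient g hx.1.le ht.1 ht.2.le

lemma length_mul_sqrt_nInf_le_integral {a b : ℝ} {g g' : ℝ → ℝ} {E : Finset ℝ}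
    (hg : ∀ x ∈ Ioo a b, x ∉ E → HasDerivAt g (g' x) x)
    (hint : IntervalIntegrable (fun x => Real.sqrt |g' x|) volume a b)
    {c d : ℝ} (hac : a ≤ c) (hcd : c ≤ d) (hdb : d ≤ b) :
    (d - c) * Real.sqrt (nInf g c d) ≤ ∫ x in a..b, Real.sqrt |g' x| := by
  have hsub : IntervalIntegrable (fun x => Real.sqrt |g' x|) volume c d :=
    hint.mono_set (by
      rw [uIcc_of_le hcd, uIcc_of_le (hac.trans (hcd.trans hdb))]
      exact Icc_subset_Icc hac hdb)
  calc (d - c) * Real.sqrt (nInf g c d) = ∫ _ in c..d, Real.sqrt (nInf g c d) := by simp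
    _ ≤ ∫ x in c..d, Real.sqrt |g' x| := by
      refine intervalIntegral.integral_mono_ae_restrict hcd (by simp) hsub ?_
      rw [Filter.EventuallyLE, ae_restrict_iff' measurableSet_Icc]
      have hfin : ((E : Set ℝ) ∪ {c, d}).Finite := E.finite_toSet.union (by simp)
      filter_upwards [(hfin.countable.ae_notMem volume)] with x hx hxI
      simp only [mem_union, mem_insert_iff, mem_singleton_iff, not_or, Finset.mem_coe] at hx
      have hxo : x ∈ Ioo c d :=
        ⟨lt_of_le_of_ne hxI.1 (Ne.symm hx.2.1), lt_of_le_of_ne hxI.2 hx.2.2⟩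
      exact Real.sqrt_le_sqrt (nInf_le_abs_deriv hxo
        (hg x ⟨hac.trans_lt hxo.1, hxo.2.trans_le hdb⟩ hx.1))
    _ ≤ ∫ x in a..b, Real.sqrt |g' x| :=
      intervalIntegral.integral_mono_interval hac hcd hdb
        (Filter.Eventually.of_forall fun _ => Real.sqrt_nonneg _) hint

lemma quotient_le_nSup {g : ℝ → ℝ} {α β K : ℝ}
    (hK : ∀ η ζ, α ≤ η → η < ζ → ζ ≤ β → |g ζ - g η| ≤ K * (ζ - η)) (h : α < β) :
    |g β - g α| / (β - α) ≤ nSup g α β := by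
  refine le_csSup ⟨K, ?_⟩ ⟨α, β, le_rfl, h, le_rfl, rfl⟩
  rintro _ ⟨s, t, h₁, h₂, h₃, rfl⟩
  rw [div_le_iff₀ (sub_pos.2 h₂)]
  exact hK s t h₁ h₂ h₃

lemma littleh_pos {a b : ℝ} (hab : a < b) {nInit : ℕ} (hn : 5 ≤ nInit) :
    0 < littleh a b nInit := by
  have : (5 : ℝ) ≤ nInit := by exact_mod_cast hn
  exact div_pos (by linarith) (by linarith)

lemma littleh_le {a b : ℝ} (hab : a < b) {nInit : ℕ} (hn : 5 ≤ nInit) :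
    littleh a b nInit ≤ 3 / 4 * (b - a) := by
  have : (5 : ℝ) ≤ nInit := by exact_mod_cast hn
  rw [littleh, div_le_iff₀ (by linarith)]
  nlinarith

/-- Taking `h₋ = h₊ = 2𝔥/3` around a short interval, the cone condition bounds its difference
quotient by the infimum of the quotients over some neighbouring interval. -/
lemma ConeWith.exists_nInf_ge {a b C₀ : ℝ} (hab : a < b) {nInit : ℕ} (hn : 5 ≤ nInit)
    {f f' : ℝ → ℝ} (hf : ConeWith a b nInit C₀ f f') {α β : ℝ} (hα : a ≤ α)
    (hαβ : α < β) (hβ : β ≤ b) (hlen : β - α < 2 * littleh a b nInit / 3) :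
    ∃ c d, a ≤ c ∧ d ≤ b ∧ d - c = 2 * littleh a b nInit / 3 - (β - α) ∧
      |f' β - f' α| / (β - α) ≤ 3 * C₀ * nInf f' c d := by
  obtain ⟨-, ⟨K, hK⟩, hcone⟩ := hf
  have hpos := littleh_pos hab hn
  have hle := littleh_le hab hn
  set h := littleh a b nInit with hh
  have hsup := quotient_le_nSup (g := f') (K := K) (fun η ζ h₁ h₂ h₃ =>
    hK η ζ (hα.trans h₁) h₂ (h₃.trans hβ)) hαβ
  have hadm : a ≤ β - 2 * h / 3 ∨ α + 2 * h / 3 ≤ b := by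
    by_contra! hcon
    linarith [hcon.1, hcon.2]
  have hB := hsup.trans (hcone α β (2 * h / 3) (2 * h / 3) hα hαβ hβ hlen (by linarith) hlen
    (by linarith) hadm)
  have hC : Cfun a b nInit C₀ (2 * h / 3) = 3 * C₀ := by
    rw [Cfun, ← hh]
    field_simp
    ring
  rw [Bfun, hC] at hB
  split_ifs at hB with hl hr
  · rcases le_max_iff.1 hB with hB | hB
    · exact ⟨_, _, hl, by linarith, by ring, hB⟩
    · exact ⟨_, _, by linarith, hr, by ring, hB⟩
  · exact ⟨_, _, hl, by linarith, by ring, hB⟩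
  · exact ⟨_, _, by linarith, hadm.resolve_left hl, by ring, hB⟩

/-- For `f` in the cone `𝒞` possessing a second derivative off finitely many
points with `√|f''|` integrable: `(4𝔥²/(27C₀))·‖f''‖_{[a,b]} ≤ (∫_a^b √|f''|)²`. -/
theorem stmt5 (a b : ℝ) (hab : a < b) (nInit : ℕ) (hn : 5 ≤ nInit)
    (C₀ : ℝ) (hC : 1 ≤ C₀) (f f' f'' : ℝ → ℝ) (E : Finset ℝ)
    (hf : ConeWith a b nInit C₀ f f')
    (hder2 : ∀ x ∈ Set.Ioo a b, x ∉ E → HasDerivAt f' (f'' x) x)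
    (hint : IntervalIntegrable (fun x => Real.sqrt |f'' x|) volume a b) :
    (4 * (littleh a b nInit) ^ 2 / (27 * C₀)) * nSup f' a b ≤
      (∫ x in a..b, Real.sqrt |f'' x|) ^ 2 := by
  have hpos := littleh_pos hab hn
  set h := littleh a b nInit with hh
  set I := ∫ x in a..b, Real.sqrt |f'' x| with hI
  have hC0 : 0 < C₀ := by linarith
  have hquot : ∀ η ζ, a ≤ η → η < ζ → ζ ≤ b →
      |f' ζ - f' η| / (ζ - η) * (4 * h ^ 2 / (27 * C₀)) ≤ I ^ 2 := by
    intro η ζ hη hηζ hζ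
    set q := |f' ζ - f' η| / (ζ - η) with hq
    have hq0 : 0 ≤ q := div_nonneg (abs_nonneg _) (sub_pos.2 hηζ).le
    have hδ : ∀ δ ∈ Ioo 0 (2 * h / 3), (2 * h / 3 - δ) * Real.sqrt (q / (3 * C₀)) ≤ I := by
      intro δ hδ
      obtain ⟨α, β, h₁, h₂, h₃, h₄, h₅⟩ := exists_short_quotient_ge f' δ hδ.1 hηζ
      obtain ⟨c, d, hc, hd, hcd, hle⟩ := hf.exists_nInf_ge hab hn (hη.trans h₁) h₂
        (h₃.trans hζ) (h₄.trans hδ.2)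
      rw [← hh] at hcd
      refine le_trans ?_ (length_mul_sqrt_nInf_le_integral hder2 hint hc
        (by linarith [hδ.2]) hd)
      have hqn : q / (3 * C₀) ≤ nInf f' c d := by
        rw [div_le_iff₀' (by positivity)]
        exact h₅.trans hle
      exact mul_le_mul (by linarith) (Real.sqrt_le_sqrt hqn) (Real.sqrt_nonneg _)
        (by linarith [hδ.2])
    have hlim : 2 * h / 3 * Real.sqrt (q / (3 * C₀)) ≤ I := by
      have htend : Filter.Tendsto (fun δ : ℝ => (2 * h / 3 - δ) * Real.sqrt (q / (3 * C₀)))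
          (nhdsWithin 0 (Ioi 0)) (nhds ((2 * h / 3 - 0) * Real.sqrt (q / (3 * C₀)))) :=
        (Continuous.tendsto (by fun_prop) 0).mono_left nhdsWithin_le_nhds
      rw [sub_zero] at htend
      refine le_of_tendsto htend ?_
      filter_upwards [Ioo_mem_nhdsGT (by positivity : 0 < 2 * h / 3)] with δ using hδ δ
    have hsq := pow_le_pow_left₀ (by positivity) hlim 2
    rw [mul_pow, Real.sq_sqrt (by positivity)] at hsq
    refine le_trans (le_of_eq ?_) hsq
    ring
  rw [mul_comm, ← le_div_iff₀ (by positivity)]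
  refine csSup_le ⟨_, a, b, le_rfl, hab, le_rfl, rfl⟩ ?_
  rintro _ ⟨η, ζ, h₁, h₂, h₃, rfl⟩
  rw [le_div_iff₀ (by positivity)]
  exact hquot η ζ h₁ h₂ h₃
end

section
/- Let a < b. For every M > 0 there exists a function f : ℝ → ℝ that is differentiable on [a,b] with Lipschitz derivative, is twice differentiable on [a,b] except at finitely many points, and satisfies (∫_a^b √|f''(x)| dx)² ≤ 1 while ‖f''‖_{[a,b]} ≥ M. In other words, sup{ ‖f''‖_{[a,b]} : f ∈ W^{2,∞}[a,b], ‖f''‖_{1/2,[a,b]} ≤ 1 } = ∞. -/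
open Set MeasureTheory

/-- `sup{‖f''‖_{[a,b]} : f ∈ W^{2,∞}[a,b], ‖f''‖_{1/2,[a,b]} ≤ 1} = ∞`:
for every `M > 0` there is `f ∈ W^{2,∞}[a,b]`, twice differentiable off
finitely many points, with `(∫_a^b √|f''|)² ≤ 1` and `‖f''‖_{[a,b]} ≥ M`. -/
theorem stmt6 (a b : ℝ) (hab : a < b) (M : ℝ) (hM : 0 < M) :
    ∃ (f f' f'' : ℝ → ℝ) (E : Finset ℝ),
      (∀ x ∈ Set.Icc a b, HasDerivWithinAt f (f' x) (Set.Icc a b) x) ∧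
      (∃ K : ℝ, ∀ η ζ, a ≤ η → η < ζ → ζ ≤ b → |f' ζ - f' η| ≤ K * (ζ - η)) ∧
      (∀ x ∈ Set.Icc a b, x ∉ E → HasDerivWithinAt f' (f'' x) (Set.Icc a b) x) ∧
      IntervalIntegrable (fun x => Real.sqrt |f'' x|) volume a b ∧
      (∫ x in a..b, Real.sqrt |f'' x|) ^ 2 ≤ 1 ∧
      M ≤ nSup f' a b := by
  have hsM : 0 < √M := Real.sqrt_pos.2 hM
  obtain ⟨c, hac, hcb, hc⟩ : ∃ c, a < c ∧ c ≤ b ∧ √M * (c - a) ≤ 1 := by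
    refine ⟨min b (a + 1 / √M), lt_min hab (by simpa using hsM), min_le_left _ _, ?_⟩
    have h : min b (a + 1 / √M) - a ≤ 1 / √M := by
      linarith [min_le_right b (a + 1 / √M)]
    calc √M * (min b (a + 1 / √M) - a) ≤ √M * (1 / √M) := by gcongr
      _ = 1 := by field_simp
  have hcont : Continuous fun x : ℝ => M * min x c := by fun_prop
  have hlip : ∀ η ζ : ℝ, η < ζ → |M * min ζ c - M * min η c| ≤ M * (ζ - η) := by
    intro η ζ h
    rw [← mul_sub, abs_mul, abs_of_pos hM]
    gcongr
    have := abs_min_sub_min_le_max ζ c η c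
    rwa [sub_self, abs_zero, max_eq_left (abs_nonneg _), abs_of_pos (sub_pos.2 h)] at this
  have hsqrt : (fun x => √|if x ≤ c then M else 0|) = {x | x ≤ c}.indicator fun _ => √M := by
    ext x
    by_cases h : x ≤ c <;> simp [h, abs_of_pos hM]
  refine ⟨fun x => ∫ t in a..x, M * min t c, fun x => M * min x c,
    fun x => if x ≤ c then M else 0, {c}, ?_, ⟨M, fun η ζ _ h _ => hlip η ζ h⟩, ?_, ?_, ?_, ?_⟩
  · exact fun x _ => (hcont.integral_hasStrictDerivAt a x).hasDerivAt.hasDerivWithinAt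
  · intro x _ hx
    refine HasDerivAt.hasDerivWithinAt ?_
    beta_reduce
    rcases lt_or_gt_of_ne (by simpa using hx : x ≠ c) with h | h
    · rw [if_pos h.le]
      have hd : HasDerivAt (fun y : ℝ => M * y) M x := by
        simpa using (hasDerivAt_id x).const_mul M
      refine hd.congr_of_eventuallyEq ?_
      filter_upwards [Iio_mem_nhds h] with y hy
      rw [min_eq_left (le_of_lt hy)]
    · rw [if_neg h.not_ge]
      refine (hasDerivAt_const x (M * c)).congr_of_eventuallyEq ?_
      filter_upwards [Ioi_mem_nhds h] with y hy
      rw [min_eq_right (le_of_lt hy)]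
  · rw [hsqrt, intervalIntegrable_iff]
    exact (intervalIntegrable_iff.1 intervalIntegrable_const).indicator measurableSet_Iic
  · rw [hsqrt, intervalIntegral.integral_indicator ⟨hac.le, hcb⟩,
      intervalIntegral.integral_const, smul_eq_mul, mul_comm]
    exact pow_le_one₀ (mul_nonneg hsM.le (sub_pos.2 hac).le) hc
  · refine le_csSup ⟨M, ?_⟩ ⟨a, c, le_rfl, hac, hcb, ?_⟩
    · rintro q ⟨η, ζ, -, h, -, rfl⟩
      exact (div_le_iff₀ (sub_pos.2 h)).2 (hlip η ζ h)
    · have h := sub_pos.2 hac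
      beta_reduce
      rw [min_self, min_eq_left hac.le, ← mul_sub, abs_of_pos (mul_pos hM h),
        mul_div_cancel_right₀ _ h.ne']
end

section
/- Let c, δ be reals with δ > 0, −1 ≤ c−2δ, and c+2δ ≤ 1, and let f₁ be the hump function defined below on [−1,1]. Then: f₁ is differentiable on [−1,1]; 0 ≤ f₁(x) ≤ 1 for all x ∈ [−1,1] with f₁(c) = 1; f₁(x) = 0 whenever x ∈ [−1,1] and |x−c| ≥ 2δ; and ‖f₁''‖_{[−1,1]} = δ^{−2}. -/
open Set MeasureTheory

/-- The hump function `f₁` on `[−1,1]` with parameters `c` and `δ`. -/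
noncomputable def hump (c δ : ℝ) (x : ℝ) : ℝ :=
  if |x - c| ≤ 2 * δ then
    (1 / (2 * δ ^ 2)) *
      (4 * δ ^ 2 + (x - c) ^ 2 + (x - c - δ) * |x - c - δ| - (x - c + δ) * |x - c + δ|)
  else 0

theorem hasDerivAt_mul_abs_self (s : ℝ) : HasDerivAt (fun s : ℝ => s * |s|) (2 * |s|) s := by
  rcases lt_trichotomy s 0 with h | rfl | h
  · refine ((hasDerivAt_id s).mul (hasDerivAt_abs_neg h)).congr_deriv ?_
    rw [abs_of_neg h, id]
    ring
  · rw [hasDerivAt_iff_tendsto_slope_zero]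
    simpa using ((continuous_abs (G := ℝ)).tendsto' 0 0 abs_zero).mono_left nhdsWithin_le_nhds
      |>.congr' (by
        filter_upwards [self_mem_nhdsWithin] with t ht
        have ht : t ≠ 0 := ht
        field_simp)
  · refine ((hasDerivAt_id s).mul (hasDerivAt_abs_pos h)).congr_deriv ?_
    rw [abs_of_pos h, id]
    ring

/-- The hump function as a combination of shifted copies of `s ↦ s|s|`, without case split. -/
theorem hump_eq (c δ : ℝ) (hδ : 0 < δ) (x : ℝ) :
    hump c δ x = (1 / (4 * δ ^ 2)) *
      ((x - (c - 2 * δ)) * |x - (c - 2 * δ)| - 2 * ((x - (c - δ)) * |x - (c - δ)|)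
        + 2 * ((x - (c + δ)) * |x - (c + δ)|) - (x - (c + 2 * δ)) * |x - (c + 2 * δ)|) := by
  have e₁ : x - c - δ = x - (c + δ) := by ring
  have e₂ : x - c + δ = x - (c - δ) := by ring
  unfold hump
  rw [e₁, e₂]
  split_ifs with h
  · obtain ⟨h₁, h₂⟩ := abs_le.1 h
    rw [abs_of_nonneg (a := x - (c - 2 * δ)) (by linarith),
      abs_of_nonpos (a := x - (c + 2 * δ)) (by linarith)]
    field_simp
    ring
  · rcases lt_abs.1 (not_le.1 h) with h | h
    · rw [abs_of_nonneg (a := x - (c - 2 * δ)) (by linarith),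
        abs_of_nonneg (a := x - (c + 2 * δ)) (by linarith),
        abs_of_nonneg (a := x - (c + δ)) (by linarith),
        abs_of_nonneg (a := x - (c - δ)) (by linarith)]
      ring
    · rw [abs_of_nonpos (a := x - (c - 2 * δ)) (by linarith),
        abs_of_nonpos (a := x - (c + 2 * δ)) (by linarith),
        abs_of_nonpos (a := x - (c + δ)) (by linarith),
        abs_of_nonpos (a := x - (c - δ)) (by linarith)]
      ring

/-- The derivative of the hump function. -/
noncomputable def humpDeriv (c δ x : ℝ) : ℝ :=
  (1 / (2 * δ ^ 2)) * (|x - (c - 2 * δ)| - 2 * |x - (c - δ)| + 2 * |x - (c + δ)|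
    - |x - (c + 2 * δ)|)

theorem hasDerivAt_hump (c δ : ℝ) (hδ : 0 < δ) (x : ℝ) :
    HasDerivAt (hump c δ) (humpDeriv c δ x) x := by
  have key (a : ℝ) : HasDerivAt (fun x : ℝ => (x - a) * |x - a|) (2 * |x - a|) x :=
    (hasDerivAt_mul_abs_self (x - a)).comp_sub_const x a
  rw [funext (hump_eq c δ hδ)]
  refine (((((key (c - 2 * δ)).sub ((key (c - δ)).const_mul 2)).add
    ((key (c + δ)).const_mul 2)).sub (key (c + 2 * δ))).const_mul (1 / (4 * δ ^ 2))).congr_deriv ?_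
  unfold humpDeriv
  field_simp
  ring

theorem abs_humpDeriv_sub_le (c δ : ℝ) (hδ : 0 < δ) {η ζ : ℝ} (h : η ≤ ζ) :
    |humpDeriv c δ ζ - humpDeriv c δ η| ≤ 1 / δ ^ 2 * (ζ - η) := by
  have key : |(|ζ - (c - 2 * δ)| - 2 * |ζ - (c - δ)| + 2 * |ζ - (c + δ)| - |ζ - (c + 2 * δ)|)
      - (|η - (c - 2 * δ)| - 2 * |η - (c - δ)| + 2 * |η - (c + δ)| - |η - (c + 2 * δ)|)|
      ≤ 2 * (ζ - η) := by
    rw [abs_le]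
    rcases abs_cases (ζ - (c - 2 * δ)) with ⟨e₁, _⟩ | ⟨e₁, _⟩ <;>
    rcases abs_cases (ζ - (c - δ)) with ⟨e₂, _⟩ | ⟨e₂, _⟩ <;> try (exfalso; linarith)
    all_goals rcases abs_cases (ζ - (c + δ)) with ⟨e₃, _⟩ | ⟨e₃, _⟩ <;> try (exfalso; linarith)
    all_goals rcases abs_cases (ζ - (c + 2 * δ)) with ⟨e₄, _⟩ | ⟨e₄, _⟩ <;>
      try (exfalso; linarith)
    all_goals rcases abs_cases (η - (c - 2 * δ)) with ⟨e₅, _⟩ | ⟨e₅, _⟩ <;>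
      try (exfalso; linarith)
    all_goals rcases abs_cases (η - (c - δ)) with ⟨e₆, _⟩ | ⟨e₆, _⟩ <;> try (exfalso; linarith)
    all_goals rcases abs_cases (η - (c + δ)) with ⟨e₇, _⟩ | ⟨e₇, _⟩ <;> try (exfalso; linarith)
    all_goals rcases abs_cases (η - (c + 2 * δ)) with ⟨e₈, _⟩ | ⟨e₈, _⟩ <;>
      try (exfalso; linarith)
    all_goals
      rw [e₁, e₂, e₃, e₄, e₅, e₆, e₇, e₈]
      constructor <;> linarith
  unfold humpDeriv
  rw [← mul_sub, abs_mul, abs_of_pos (by positivity)]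
  calc _ ≤ 1 / (2 * δ ^ 2) * (2 * (ζ - η)) := by gcongr
    _ = _ := by field_simp

theorem nSup_humpDeriv (c δ : ℝ) (hδ : 0 < δ) {α β : ℝ} (hα : α ≤ c) (hβ : c + δ ≤ β) :
    nSup (humpDeriv c δ) α β = 1 / δ ^ 2 := by
  refine IsGreatest.csSup_eq ⟨⟨c, c + δ, hα, by linarith, hβ, ?_⟩, ?_⟩
  · have h₀ : humpDeriv c δ c = 0 := by
      unfold humpDeriv
      rw [abs_of_nonneg (by linarith), abs_of_nonneg (by linarith), abs_of_nonpos (by linarith),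
        abs_of_nonpos (by linarith)]
      ring
    have h₁ : humpDeriv c δ (c + δ) = -(1 / δ) := by
      unfold humpDeriv
      rw [abs_of_nonneg (by linarith), abs_of_nonneg (by linarith), sub_self, abs_zero,
        abs_of_nonpos (by linarith)]
      field_simp
      ring
    rw [h₀, h₁, sub_zero, abs_neg, abs_of_pos (by positivity), add_sub_cancel_left]
    field_simp
  · rintro q ⟨η, ζ, -, h, -, rfl⟩
    rw [div_le_iff₀ (sub_pos.2 h)]
    exact abs_humpDeriv_sub_le c δ hδ h.le

theorem hump_mem_Icc (c δ : ℝ) (hδ : 0 < δ) (x : ℝ) : hump c δ x ∈ Set.Icc (0 : ℝ) 1 := by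
  unfold hump
  split_ifs with h
  · obtain ⟨h₁, h₂⟩ := abs_le.1 h
    rw [one_div_mul_eq_div, Set.mem_Icc, le_div_iff₀ (by positivity), div_le_iff₀ (by positivity)]
    rcases abs_cases (x - c - δ) with ⟨e₁, _⟩ | ⟨e₁, _⟩ <;>
    rcases abs_cases (x - c + δ) with ⟨e₂, _⟩ | ⟨e₂, _⟩ <;> rw [e₁, e₂] <;>
    constructor <;> nlinarith
  · simp

theorem hump_self (c δ : ℝ) (hδ : 0 < δ) : hump c δ c = 1 := by
  simp only [hump, sub_self, abs_zero, zero_sub, zero_add, abs_neg, abs_of_pos hδ]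
  rw [if_pos (by positivity)]
  field_simp
  ring

theorem hump_eq_zero (c δ : ℝ) (hδ : 0 < δ) {x : ℝ} (h : 2 * δ ≤ |x - c|) : hump c δ x = 0 := by
  rcases h.lt_or_eq with h | h
  · exact if_neg (not_le.2 h)
  · unfold hump
    rw [if_pos h.ge]
    rcases eq_or_eq_neg_of_abs_eq h.symm with h | h
    · rw [h, abs_of_nonneg (by linarith), abs_of_nonneg (by linarith)]
      ring
    · rw [h, abs_of_nonpos (by linarith), abs_of_nonpos (by linarith)]
      ring

/-- Basic properties of the hump function `f₁`: it is differentiable on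
`[−1,1]`, takes values in `[0,1]` with `f₁(c) = 1`, vanishes for
`|x−c| ≥ 2δ`, and `‖f₁''‖_{[−1,1]} = δ⁻²`. -/
theorem stmt8 (c δ : ℝ) (hδ : 0 < δ) (hl : -1 ≤ c - 2 * δ) (hr : c + 2 * δ ≤ 1) :
    (∃ f' : ℝ → ℝ,
      (∀ x ∈ Set.Icc (-1 : ℝ) 1, HasDerivWithinAt (hump c δ) (f' x) (Set.Icc (-1 : ℝ) 1) x) ∧
      nSup f' (-1) 1 = 1 / δ ^ 2) ∧
    (∀ x ∈ Set.Icc (-1 : ℝ) 1, 0 ≤ hump c δ x ∧ hump c δ x ≤ 1) ∧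
    hump c δ c = 1 ∧
    (∀ x ∈ Set.Icc (-1 : ℝ) 1, 2 * δ ≤ |x - c| → hump c δ x = 0) := by
  exact ⟨⟨humpDeriv c δ, fun x _ => (hasDerivAt_hump c δ hδ x).hasDerivWithinAt,
      nSup_humpDeriv c δ hδ (by linarith) (by linarith)⟩,
    fun x _ => hump_mem_Icc c δ hδ x, hump_self c δ hδ, fun x _ h => hump_eq_zero c δ hδ h⟩
end

section
/- Let the cone 𝒞 = 𝒞(−1, 1, n_init, C₀) be defined as below with a = −1, b = 1, integer n_init ≥ 5, and C₀ ≥ 1, and set 𝔥 = 6/(n_init − 1). Let c, δ be reals with δ > 0, −1 ≤ c−2δ, c+2δ ≤ 1, and let f₁ be the hump function defined below. If δ < 2𝔥, then f₁ ∉ 𝒞, regardless of how large C₀ ≥ 1 is chosen. -/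
open Set MeasureTheory

theorem eq_of_hasDerivWithinAt_of_eqOn {f g : ℝ → ℝ} {a b p q x y z : ℝ}
    (hf : HasDerivWithinAt f y (Icc a b) x) (hap : a ≤ p) (hpq : p < q) (hqb : q ≤ b)
    (hx : x ∈ Icc p q) (hfg : EqOn f g (Icc p q)) (hg : HasDerivAt g z x) : y = z := by
  have hf' : HasDerivWithinAt f y (Icc p q) x := hf.mono (Icc_subset_Icc hap hqb)
  have hg' : HasDerivWithinAt f z (Icc p q) x :=
    hg.hasDerivWithinAt.congr hfg (hfg hx)
  exact (uniqueDiffOn_Icc hpq x hx).eq_deriv _ hf' hg'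

theorem nInf_nonpos {f' : ℝ → ℝ} {α β η ζ : ℝ} (h₁ : α ≤ η) (h₂ : η < ζ) (h₃ : ζ ≤ β)
    (h : f' ζ = f' η) : nInf f' α β ≤ 0 := by
  refine csInf_le ⟨0, ?_⟩ ⟨η, ζ, h₁, h₂, h₃, by simp [h]⟩
  rintro q ⟨x, y, -, hxy, -, rfl⟩
  exact div_nonneg (abs_nonneg _) (sub_nonneg.2 hxy.le)

theorem le_nSup {f' : ℝ → ℝ} {a b α β K : ℝ}
    (hK : ∀ η ζ, a ≤ η → η < ζ → ζ ≤ b → |f' ζ - f' η| ≤ K * (ζ - η))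
    (ha : a ≤ α) (h : α < β) (hb : β ≤ b) :
    |f' β - f' α| / (β - α) ≤ nSup f' α β := by
  refine le_csSup ⟨K, ?_⟩ ⟨α, β, le_rfl, h, le_rfl, rfl⟩
  rintro q ⟨x, y, hx, hxy, hy, rfl⟩
  exact (div_le_iff₀ (sub_pos.2 hxy)).2 (hK x y (ha.trans hx) hxy (hy.trans hb))

theorem hump_eqOn_left {c δ : ℝ} (hδ : 0 < δ) :
    EqOn (hump c δ) (fun x => (x - (c - 2 * δ)) ^ 2 / (2 * δ ^ 2))
      (Icc (c - 2 * δ) (c - δ)) := by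
  rintro x ⟨h₁, h₂⟩
  have h : |x - c| ≤ 2 * δ := abs_le.2 ⟨by linarith, by linarith⟩
  simp only [hump, if_pos h]
  rw [abs_of_nonpos (by linarith : x - c - δ ≤ 0), abs_of_nonpos (by linarith : x - c + δ ≤ 0)]
  field_simp
  ring

theorem hump_eqOn_middle {c δ : ℝ} (hδ : 0 < δ) :
    EqOn (hump c δ) (fun x => 1 - (x - c) ^ 2 / (2 * δ ^ 2)) (Icc (c - δ) (c + δ)) := by
  rintro x ⟨h₁, h₂⟩
  have h : |x - c| ≤ 2 * δ := abs_le.2 ⟨by linarith, by linarith⟩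
  simp only [hump, if_pos h]
  rw [abs_of_nonpos (by linarith : x - c - δ ≤ 0), abs_of_nonneg (by linarith : 0 ≤ x - c + δ)]
  field_simp
  ring

theorem hump_eqOn_zero {c δ : ℝ} (hδ : 0 < δ) (a : ℝ) :
    EqOn (hump c δ) (fun _ => 0) (Icc a (c - 2 * δ)) := by
  rintro x ⟨-, h₂⟩
  rcases h₂.eq_or_lt with rfl | h₂
  · simpa using hump_eqOn_left (c := c) hδ ⟨le_rfl, by linarith⟩
  · have h : ¬ |x - c| ≤ 2 * δ := fun h => by linarith [(abs_le.1 h).1]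
    simp only [hump, if_neg h]

theorem hasDerivAt_sq_sub_div (p s x : ℝ) :
    HasDerivAt (fun x : ℝ => (x - p) ^ 2 / (2 * s)) ((x - p) / s) x := by
  refine (((hasDerivAt_id' x).sub_const p).fun_pow 2 |>.div_const (2 * s)).congr_deriv ?_
  rw [← mul_div_mul_left (x - p) s two_ne_zero]
  norm_num

/-- If the hump is too narrow, `δ < 2𝔥`, then `f₁ ∉ 𝒞(−1,1,n_init,C₀)`,
no matter how large `C₀ ≥ 1` is. -/
theorem stmt11 (nInit : ℕ) (hn : 5 ≤ nInit) (C₀ : ℝ) (hC : 1 ≤ C₀)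
    (c δ : ℝ) (hδ : 0 < δ) (hl : -1 ≤ c - 2 * δ) (hr : c + 2 * δ ≤ 1)
    (hnarrow : δ < 2 * littleh (-1) 1 nInit) :
    ¬ InCone (-1) 1 nInit C₀ (hump c δ) := by
  rintro ⟨f', hd, ⟨K, hK⟩, hB⟩
  set H := littleh (-1) 1 nInit with hH
  obtain ⟨ε, hε, hε'⟩ : ∃ ε, 0 < ε ∧ ε < min (δ / 4) ((H - δ / 2) / 2) :=
    exists_between (lt_min (by linarith) (by linarith))
  obtain ⟨hε₁, hε₂⟩ := lt_min_iff.1 hε'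
  have left (x : ℝ) (hx : x ∈ Icc (c - 2 * δ) (c - δ)) : f' x = (x - (c - 2 * δ)) / δ ^ 2 :=
    eq_of_hasDerivWithinAt_of_eqOn (hd x ⟨by linarith [hx.1], by linarith [hx.2]⟩) hl
      (by linarith) (by linarith) hx (hump_eqOn_left hδ) (hasDerivAt_sq_sub_div _ _ _)
  have middle (x : ℝ) (hx : x ∈ Icc (c - δ) (c + δ)) : f' x = -((x - c) / δ ^ 2) :=
    eq_of_hasDerivWithinAt_of_eqOn (hd x ⟨by linarith [hx.1], by linarith [hx.2]⟩)
      (by linarith) (by linarith) (by linarith) hx (hump_eqOn_middle hδ)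
      ((hasDerivAt_sq_sub_div _ _ _).const_sub 1)
  set α := c - 3 * δ / 2 - ε with hα
  set β := c - 3 * δ / 2 + ε with hβ
  set h := δ / 2 + 2 * ε with hh
  have hhH : h < H := by linarith
  have hC₀ : 0 ≤ Cfun (-1) 1 nInit C₀ h :=
    div_nonneg (mul_nonneg (by linarith) (by linarith)) (by linarith)
  have key := hB α β h h (by linarith) (by linarith) (by linarith) (by linarith) hhH
    (by linarith) hhH (Or.inr (by linarith))
  have hsup : 0 < nSup f' α β := by
    refine lt_of_lt_of_le ?_ (le_nSup hK (by linarith) (by linarith) (by linarith))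
    rw [left β ⟨by linarith, by linarith⟩, left α ⟨by linarith, by linarith⟩, ← sub_div]
    refine div_pos (abs_pos.2 (ne_of_gt (div_pos ?_ (by positivity)))) ?_ <;> linarith
  have hright : nInf f' β (α + h) ≤ 0 := by
    refine nInf_nonpos (η := c - δ - ε) (ζ := c - δ + ε) (by linarith) (by linarith)
      (by linarith) ?_
    rw [middle _ ⟨by linarith, by linarith⟩, left _ ⟨by linarith, by linarith⟩, ← neg_div]
    congr 1
    ring
  have hleft (ha : -1 ≤ β - h) : nInf f' (β - h) α ≤ 0 := by
    refine nInf_nonpos (η := c - 2 * δ - ε) (ζ := c - 2 * δ) (by linarith) (by linarith)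
      (by linarith) ?_
    rw [left _ ⟨le_rfl, by linarith⟩, sub_self, zero_div]
    exact (eq_of_hasDerivWithinAt_of_eqOn (hd _ ⟨by linarith, by linarith⟩) le_rfl
      (by linarith) (by linarith) ⟨by linarith, by linarith⟩ (hump_eqOn_zero hδ (-1))
      (hasDerivAt_const _ _)).symm
  have hb : α + h ≤ 1 := by linarith
  have hbound : Bfun (-1) 1 nInit C₀ f' α β h h ≤ 0 := by
    unfold Bfun
    split_ifs with ha
    · exact max_le (mul_nonpos_of_nonneg_of_nonpos hC₀ (hleft ha))
        (mul_nonpos_of_nonneg_of_nonpos hC₀ hright)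
    · exact mul_nonpos_of_nonneg_of_nonpos hC₀ hright
  linarith
end

section
/- (Fooling-function lemma underlying the infinite lower complexity bound on the ball of the L^{1/2}-quasi-norm.) Let a < b, σ > 0, n ∈ ℕ, and let x₁, …, xₙ be any points in [a,b]. Then there exists a function g : ℝ → ℝ that is differentiable on [a,b] with Lipschitz derivative, twice differentiable on [a,b] except at finitely many points, such that g(xᵢ) = 0 for all i = 1,…,n, (∫_a^b √|g''(x)| dx)² ≤ σ, and sup_{x∈[a,b]} |g(x)| ≥ σ/16. Consequently, no algorithm using finitely many function values can achieve L^∞-error tolerance ε < σ/16 for all functions in the ball {f ∈ W^{2,∞}[a,b] : ‖f''‖_{1/2,[a,b]} ≤ σ}. -/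
open Set MeasureTheory

/-- The indicator function of the positive half-line, the derivative of `max t 0` off `0`. -/
noncomputable def heaviside (t : ℝ) : ℝ := if 0 < t then 1 else 0

theorem hasDerivAt_max_zero {t : ℝ} (ht : t ≠ 0) :
    HasDerivAt (fun s : ℝ => max s 0) (heaviside t) t := by
  rcases lt_or_gt_of_ne ht with h | h
  · rw [heaviside, if_neg h.not_gt]
    refine (hasDerivAt_const t (0 : ℝ)).congr_of_eventuallyEq ?_
    filter_upwards [Iio_mem_nhds h] with s hs using max_eq_right (le_of_lt hs)
  · rw [heaviside, if_pos h]
    refine (hasDerivAt_id t).congr_of_eventuallyEq ?_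
    filter_upwards [Ioi_mem_nhds h] with s hs using max_eq_left (le_of_lt hs)

theorem hasDerivAt_max_zero_sq (t : ℝ) :
    HasDerivAt (fun s : ℝ => (max s 0) ^ 2 / 2) (max t 0) t := by
  have key : ∀ y : ℝ, y ≠ 0 → HasDerivAt (fun s : ℝ => (max s 0) ^ 2 / 2) (max y 0) y := by
    intro y hy
    refine (((hasDerivAt_max_zero hy).pow 2).div_const 2).congr_deriv ?_
    rcases lt_or_gt_of_ne hy with h | h
    · simp [heaviside, h.not_gt, h.le]
    · simp [heaviside, h, h.le]
  by_cases ht : t = 0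
  · subst ht
    exact hasDerivAt_of_hasDerivAt_of_ne (g := fun y => max y 0) key
      (Continuous.continuousAt (by fun_prop)) (Continuous.continuousAt (by fun_prop))
  · exact key t ht

/-- Second difference pattern `1, -2, 2, -1` of a function at the knots
`p - 2 h, p - h, p + h, p + 2 h`. -/
def knotComb (p h : ℝ) (f : ℝ → ℝ) (t : ℝ) : ℝ :=
  f (t - (p - 2 * h)) - 2 * f (t - (p - h)) + 2 * f (t - (p + h)) - f (t - (p + 2 * h))

theorem HasDerivAt.knotComb {p h t : ℝ} {f f' : ℝ → ℝ}
    (h₁ : HasDerivAt f (f' (t - (p - 2 * h))) (t - (p - 2 * h)))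
    (h₂ : HasDerivAt f (f' (t - (p - h))) (t - (p - h)))
    (h₃ : HasDerivAt f (f' (t - (p + h))) (t - (p + h)))
    (h₄ : HasDerivAt f (f' (t - (p + 2 * h))) (t - (p + 2 * h))) :
    HasDerivAt (knotComb p h f) (knotComb p h f' t) t :=
  (((h₁.comp_sub_const t _).sub ((h₂.comp_sub_const t _).const_mul 2)).add
    ((h₃.comp_sub_const t _).const_mul 2)).sub (h₄.comp_sub_const t _)

theorem knotComb_sq_eq_zero {p h t : ℝ} (hh : 0 < h) (ht : t ∉ Ioo (p - 2 * h) (p + 2 * h)) :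
    knotComb p h (fun s => (max s 0) ^ 2 / 2) t = 0 := by
  unfold knotComb
  beta_reduce
  by_cases h1 : t ≤ p - 2 * h
  · rw [max_eq_right (by linarith), max_eq_right (by linarith), max_eq_right (by linarith),
      max_eq_right (by linarith)]
    ring
  · have h2 : p + 2 * h ≤ t := by
      by_contra h2
      exact ht ⟨not_le.mp h1, not_le.mp h2⟩
    rw [max_eq_left (by linarith), max_eq_left (by linarith), max_eq_left (by linarith),
      max_eq_left (by linarith)]
    ring

theorem knotComb_sq_center {p h : ℝ} (hh : 0 < h) :
    knotComb p h (fun s => (max s 0) ^ 2 / 2) p = h ^ 2 := by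
  unfold knotComb
  beta_reduce
  rw [max_eq_left (by linarith), max_eq_left (by linarith), max_eq_right (by linarith),
    max_eq_right (by linarith)]
  ring

theorem abs_knotComb_heaviside {p h : ℝ} (hh : 0 < h) (t : ℝ) :
    |knotComb p h heaviside t| = (Ioc (p - 2 * h) (p + 2 * h)).indicator (fun _ => 1) t := by
  unfold knotComb heaviside
  simp only [Set.indicator, mem_Ioc, sub_pos]
  split_ifs <;> first | (exfalso; grind) | norm_num

theorem abs_knotComb_max_sub_le (p h η ζ : ℝ) (hηζ : η ≤ ζ) :
    |knotComb p h (fun s => max s 0) ζ - knotComb p h (fun s => max s 0) η| ≤ 6 * (ζ - η) := by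
  have key : ∀ k : ℝ, |max (ζ - k) 0 - max (η - k) 0| ≤ ζ - η := fun k => by
    refine (abs_max_sub_max_le_abs _ _ _).trans_eq ?_
    rw [sub_sub_sub_cancel_right, abs_of_nonneg (sub_nonneg.mpr hηζ)]
  have h₁ := abs_le.mp (key (p - 2 * h))
  have h₂ := abs_le.mp (key (p - h))
  have h₃ := abs_le.mp (key (p + h))
  have h₄ := abs_le.mp (key (p + 2 * h))
  unfold knotComb
  rw [abs_le]
  constructor <;> linarith

theorem exists_gap {a b : ℝ} (hab : a < b) {s : Set ℝ} (hs : s.Finite) :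
    ∃ p ∈ Icc a b, ∃ h > 0, ∀ y ∈ s, y ∉ Ioo (p - 2 * h) (p + 2 * h) := by
  obtain ⟨p, hp, hps⟩ := (Icc_infinite hab).exists_notMem_finite hs
  obtain ⟨ε, hε, hball⟩ := Metric.isOpen_iff.mp hs.isClosed.isOpen_compl p hps
  refine ⟨p, hp, ε / 2, half_pos hε, fun y hy hmem => hball ?_ hy⟩
  rwa [mul_div_cancel₀ ε two_ne_zero, ← Real.ball_eq_Ioo] at hmem

/-- Fooling-function lemma for the `L^{1/2}`-ball: given any `n` data sites in
`[a,b]` and any `σ > 0`, there is `g ∈ W^{2,∞}[a,b]`, twice differentiable off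
finitely many points, vanishing at all data sites, with
`(∫_a^b √|g''|)² ≤ σ` and `sup_{[a,b]} |g| ≥ σ/16`. -/
theorem stmt12 (a b σ : ℝ) (hab : a < b) (hσ : 0 < σ)
    (n : ℕ) (x : Fin n → ℝ) (hx : ∀ i, x i ∈ Set.Icc a b) :
    ∃ (g g' g'' : ℝ → ℝ) (E : Finset ℝ),
      (∀ t ∈ Set.Icc a b, HasDerivWithinAt g (g' t) (Set.Icc a b) t) ∧
      (∃ K : ℝ, ∀ η ζ, a ≤ η → η < ζ → ζ ≤ b → |g' ζ - g' η| ≤ K * (ζ - η)) ∧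
      (∀ t ∈ Set.Icc a b, t ∉ E → HasDerivWithinAt g' (g'' t) (Set.Icc a b) t) ∧
      IntervalIntegrable (fun t => Real.sqrt |g'' t|) volume a b ∧
      (∀ i, g (x i) = 0) ∧
      (∫ t in a..b, Real.sqrt |g'' t|) ^ 2 ≤ σ ∧
      ∃ t ∈ Set.Icc a b, σ / 16 ≤ |g t| := by
  obtain ⟨p, hp, h, hh, hgap⟩ := exists_gap hab (Set.finite_range x)
  set M : ℝ := σ / (16 * h ^ 2) with hM
  have hM0 : 0 < M := by positivity
  have hMh : M * h ^ 2 = σ / 16 := by rw [hM]; field_simp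
  have hsqrt : (fun t => Real.sqrt |M * knotComb p h heaviside t|) =
      (Ioc (p - 2 * h) (p + 2 * h)).indicator (fun _ => Real.sqrt M) := by
    funext t
    rw [abs_mul, abs_of_pos hM0, abs_knotComb_heaviside hh]
    by_cases ht : t ∈ Ioc (p - 2 * h) (p + 2 * h) <;> simp [ht]
  refine ⟨fun t => M * knotComb p h (fun s => (max s 0) ^ 2 / 2) t,
    fun t => M * knotComb p h (fun s => max s 0) t, fun t => M * knotComb p h heaviside t,
    {p - 2 * h, p - h, p + h, p + 2 * h}, ?_, ⟨M * 6, ?_⟩, ?_, ?_, ?_, ?_, p, hp, ?_⟩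
  · intro t _
    exact ((HasDerivAt.knotComb (hasDerivAt_max_zero_sq _) (hasDerivAt_max_zero_sq _)
      (hasDerivAt_max_zero_sq _) (hasDerivAt_max_zero_sq _)).const_mul M).hasDerivWithinAt
  · intro η ζ _ hηζ _
    rw [← mul_sub, abs_mul, abs_of_pos hM0, mul_assoc]
    exact mul_le_mul_of_nonneg_left (abs_knotComb_max_sub_le p h η ζ hηζ.le) hM0.le
  · intro t _ ht
    simp only [Finset.mem_insert, Finset.mem_singleton, not_or] at ht
    obtain ⟨h₁, h₂, h₃, h₄⟩ := ht
    exact ((HasDerivAt.knotComb (hasDerivAt_max_zero (sub_ne_zero.mpr h₁))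
      (hasDerivAt_max_zero (sub_ne_zero.mpr h₂)) (hasDerivAt_max_zero (sub_ne_zero.mpr h₃))
      (hasDerivAt_max_zero (sub_ne_zero.mpr h₄))).const_mul M).hasDerivWithinAt
  · rw [hsqrt, intervalIntegrable_iff]
    exact (integrableOn_const (by simp)).indicator measurableSet_Ioc
  · intro i
    simp [knotComb_sq_eq_zero hh (hgap _ (mem_range_self i))]
  · have hvol : volume.real (Ioc a b ∩ Ioc (p - 2 * h) (p + 2 * h)) ≤ 4 * h := by
      refine (measureReal_mono inter_subset_right (by simp)).trans_eq ?_
      rw [Real.volume_real_Ioc_of_le (by linarith)]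
      ring
    rw [hsqrt, intervalIntegral.integral_of_le hab.le, setIntegral_indicator measurableSet_Ioc,
      setIntegral_const, smul_eq_mul, mul_pow, Real.sq_sqrt hM0.le]
    calc _ ≤ (4 * h) ^ 2 * M := by gcongr
      _ = σ := by linear_combination 16 * hMh
  · simp only [knotComb_sq_center hh, hMh]
    exact le_abs_self _
end

section
/- Let a < b, let n_init ≥ 5 be an integer, let C₀ ≥ 1, and let 𝒞 = 𝒞(a,b,n_init,C₀) be the cone defined below. Let f ∈ W^{2,∞}[a,b] and suppose that ‖f''‖_{−∞,[α,β]} ≥ (1/C₀)·‖f''‖_{[a,b]} for every subinterval [α,β] ⊆ [a,b] with α < β. Then f ∈ 𝒞. -/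
open Set MeasureTheory

theorem nSup_nonneg (f' : ℝ → ℝ) (α β : ℝ) : 0 ≤ nSup f' α β := by
  apply Real.sSup_nonneg
  rintro q ⟨η, ζ, -, h, -, rfl⟩
  exact div_nonneg (abs_nonneg _) (sub_pos.2 h).le

/-- For a Lipschitz derivative, `nSup` is monotone in the interval. -/
theorem nSup_mono {f' : ℝ → ℝ} {a b α β : ℝ}
    (hlip : ∃ K : ℝ, ∀ η ζ, a ≤ η → η < ζ → ζ ≤ b → |f' ζ - f' η| ≤ K * (ζ - η))
    (ha : a ≤ α) (hαβ : α < β) (hb : β ≤ b) : nSup f' α β ≤ nSup f' a b := by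
  obtain ⟨K, hK⟩ := hlip
  apply csSup_le_csSup
  · refine ⟨K, ?_⟩
    rintro q ⟨η, ζ, h₁, h₂, h₃, rfl⟩
    exact (div_le_iff₀ (sub_pos.2 h₂)).2 (hK η ζ h₁ h₂ h₃)
  · exact ⟨_, α, β, le_rfl, hαβ, le_rfl, rfl⟩
  · rintro q ⟨η, ζ, h₁, h₂, h₃, rfl⟩
    exact ⟨η, ζ, ha.trans h₁, h₂, h₃.trans hb, rfl⟩

theorem le_Cfun {a b : ℝ} {nInit : ℕ} {C₀ h : ℝ} (hC : 0 ≤ C₀) (h₀ : 0 ≤ h)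
    (hh : h < littleh a b nInit) : C₀ ≤ Cfun a b nInit C₀ h := by
  rw [Cfun, le_div_iff₀ (sub_pos.2 hh)]
  exact mul_le_mul_of_nonneg_left (sub_le_self _ h₀) hC

/-- If `f ∈ W^{2,∞}[a,b]` satisfies
`‖f''‖_{−∞,[α,β]} ≥ (1/C₀)‖f''‖_{[a,b]}` for every subinterval
`[α,β] ⊆ [a,b]`, then `f ∈ 𝒞(a,b,n_init,C₀)`. -/
theorem stmt15 (a b : ℝ) (hab : a < b) (nInit : ℕ) (hn : 5 ≤ nInit)
    (C₀ : ℝ) (hC : 1 ≤ C₀) (f f' : ℝ → ℝ)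
    (hder : ∀ x ∈ Set.Icc a b, HasDerivWithinAt f (f' x) (Set.Icc a b) x)
    (hlip : ∃ K : ℝ, ∀ η ζ, a ≤ η → η < ζ → ζ ≤ b → |f' ζ - f' η| ≤ K * (ζ - η))
    (hmin : ∀ α β, a ≤ α → α < β → β ≤ b →
      (1 / C₀) * nSup f' a b ≤ nInf f' α β) :
    ConeWith a b nInit C₀ f f' := by
  refine ⟨hder, hlip, fun α β hm hp ha hαβ hb hm₁ hm₂ hp₁ hp₂ hor => ?_⟩
  have hC₀ : 0 < C₀ := by linarith
  have key : ∀ u v h, a ≤ u → u < v → v ≤ b → 0 ≤ h → h < littleh a b nInit →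
      nSup f' α β ≤ Cfun a b nInit C₀ h * nInf f' u v := by
    intro u v h hu huv hv h₀ hh
    have hinf := hmin u v hu huv hv
    have hnonneg : 0 ≤ nInf f' u v :=
      (mul_nonneg (one_div_pos.2 hC₀).le (nSup_nonneg f' a b)).trans hinf
    calc nSup f' α β ≤ nSup f' a b := nSup_mono hlip ha hαβ hb
      _ = C₀ * (1 / C₀ * nSup f' a b) := by field_simp
      _ ≤ C₀ * nInf f' u v := mul_le_mul_of_nonneg_left hinf hC₀.le
      _ ≤ Cfun a b nInit C₀ h * nInf f' u v :=
        mul_le_mul_of_nonneg_right (le_Cfun hC₀.le h₀ hh) hnonneg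
  have left (h : a ≤ β - hm) := key (β - hm) α hm h (by linarith) (by linarith)
    (by linarith) hm₂
  have right (h : α + hp ≤ b) := key β (α + hp) hp (by linarith) (by linarith) h
    (by linarith) hp₂
  unfold Bfun
  split_ifs with h₁ h₂
  · exact le_max_of_le_left (left h₁)
  · exact left h₁
  · exact right (hor.resolve_left h₁)
end

section
/- Let α < β and let f : ℝ → ℝ be differentiable on [α,β] with |f'(ζ) − f'(η)| ≤ K·(ζ − η) for all α ≤ η < ζ ≤ β (i.e., f' is Lipschitz with constant K on [α,β]). Then for every x ∈ [α,β], f(x) ≥ min(f(α), f(β)) − K·(β−α)²/8. Equivalently, min(f(α), f(β)) − inf_{x∈[α,β]} f(x) ≤ K·(β−α)²/8. -/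
/-- If the derivative of `f` on `[a, b]` has one-sided Lipschitz constant `K`, then
`x ↦ f x - K / 2 * x ^ 2` is concave on `[a, b]`. -/
theorem concaveOn_sub_sq_of_derivWithin_le {a b K : ℝ} {f f' : ℝ → ℝ}
    (hder : ∀ x ∈ Set.Icc a b, HasDerivWithinAt f (f' x) (Set.Icc a b) x)
    (hlip : ∀ y z, a ≤ y → y < z → z ≤ b → f' z - f' y ≤ K * (z - y)) :
    ConcaveOn ℝ (Set.Icc a b) (fun x => f x - K / 2 * x ^ 2) := by
  have hg : ∀ x ∈ Set.Icc a b, HasDerivWithinAt (fun x => f x - K / 2 * x ^ 2)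
      (f' x - K * x) (Set.Icc a b) x := fun x hx => by
    have hsq : HasDerivWithinAt (fun x : ℝ => K / 2 * x ^ 2) (K / 2 * (2 * x))
        (Set.Icc a b) x := by
      simpa using ((hasDerivAt_pow 2 x).const_mul (K / 2)).hasDerivWithinAt
    exact ((hder x hx).sub hsq).congr_deriv (by ring)
  have hderiv : ∀ x ∈ interior (Set.Icc a b),
      HasDerivAt (fun x => f x - K / 2 * x ^ 2) (f' x - K * x) x := fun x hx =>
    (hg x (interior_subset hx)).hasDerivAt (mem_interior_iff_mem_nhds.mp hx)
  refine AntitoneOn.concaveOn_of_deriv (convex_Icc a b)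
    (fun x hx => (hg x hx).continuousWithinAt)
    (fun x hx => (hderiv x hx).differentiableAt.differentiableWithinAt) ?_
  intro y hy z hz hyz
  rw [(hderiv y hy).deriv, (hderiv z hz).deriv]
  rcases hyz.eq_or_lt with rfl | hlt
  · rfl
  · linarith [hlip y z (interior_subset hy).1 hlt (interior_subset hz).2]

/-- If `f'` is Lipschitz with constant `K` on `[α,β]`, then for every
`x ∈ [α,β]`, `f(x) ≥ min(f(α), f(β)) − K(β−α)²/8`. -/
theorem stmt17 (α β K : ℝ) (hαβ : α < β) (hK : 0 ≤ K) (f f' : ℝ → ℝ)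
    (hder : ∀ x ∈ Set.Icc α β, HasDerivWithinAt f (f' x) (Set.Icc α β) x)
    (hlip : ∀ η ζ, α ≤ η → η < ζ → ζ ≤ β → |f' ζ - f' η| ≤ K * (ζ - η)) :
    ∀ x ∈ Set.Icc α β, min (f α) (f β) - K * (β - α) ^ 2 / 8 ≤ f x := by
  intro x hx
  have hconc := concaveOn_sub_sq_of_derivWithin_le hder
    fun y z hy hyz hz => (le_abs_self _).trans (hlip y z hy hyz hz)
  rw [← segment_eq_Icc hαβ.le] at hx
  obtain ⟨s, t, hs, ht, hst, rfl⟩ := hx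
  have key := hconc.2 (Set.left_mem_Icc.mpr hαβ.le) (Set.right_mem_Icc.mpr hαβ.le) hs ht hst
  obtain rfl : t = 1 - s := by linarith
  simp only [smul_eq_mul] at key ⊢
  have hmin : min (f α) (f β) ≤ s * f α + (1 - s) * f β := by
    linarith [mul_le_mul_of_nonneg_left (min_le_left (f α) (f β)) hs,
      mul_le_mul_of_nonneg_left (min_le_right (f α) (f β)) ht]
  linarith [mul_nonneg hK (sq_nonneg ((2 * s - 1) * (β - α)))]
end
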